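/- arXiv:1406.4584 — 6 statements merged into one kernel-verified Lean document; each statement's English description precedes it below -/
import Mathlib

section
/- Let A be an m×m real matrix. Then A is Schur-stable if and only if there exists a symmetric positive definite m×m real matrix U such that U − A U Aᵀ is positive definite. -/
open Matrix

/-- An `m × m` real matrix is Schur-stable if every eigenvalue of it,
regarded as a matrix over `ℂ`, has modulus strictly less than `1`. -/
def SchurStable {m : ℕ} (A : Matrix (Fin m) (Fin m) ℝ) : Prop :=
  ∀ μ ∈ spectrum ℂ (A.map Complex.ofReal), ‖μ‖ < 1

open Filter Topology

/-- In a complex Banach algebra, the powers of an element of spectral radius less than `1` tend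
to zero. -/
theorem tendsto_pow_atTop_nhds_zero_of_spectralRadius_lt_one {B : Type*} [NormedRing B]
    [NormedAlgebra ℂ B] [CompleteSpace B] {a : B} (ha : spectralRadius ℂ a < 1) :
    Tendsto (fun n : ℕ => a ^ n) atTop (𝓝 0) := by
  obtain ⟨r, har, hr⟩ := ENNReal.lt_iff_exists_nnreal_btwn.mp ha
  have hr' : r < 1 := by exact_mod_cast hr
  have hev :=
    (spectrum.pow_nnnorm_pow_one_div_tendsto_nhds_spectralRadius a).eventually_lt_const har
  refine squeeze_zero_norm' ?_ (tendsto_pow_atTop_nhds_zero_of_lt_one r.coe_nonneg hr')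
  filter_upwards [hev, eventually_gt_atTop 0] with n hn hn0
  have hn0' : (0 : ℝ) < n := by exact_mod_cast hn0
  have h := ENNReal.rpow_le_rpow hn.le hn0'.le
  rw [← ENNReal.rpow_mul, one_div_mul_cancel hn0'.ne', ENNReal.rpow_one,
    ENNReal.rpow_natCast] at h
  exact_mod_cast h

namespace Matrix

variable {n : Type*} [Fintype n] [DecidableEq n]

open scoped Matrix.Norms.L2Operator in
theorem tendsto_pow_atTop_nhds_zero_of_forall_mem_spectrum {B : Matrix n n ℂ}
    (hB : ∀ μ ∈ spectrum ℂ B, ‖μ‖ < 1) : Tendsto (fun k : ℕ => B ^ k) atTop (𝓝 0) := by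
  cases isEmpty_or_nonempty n
  · exact tendsto_const_nhds.congr fun _ => Subsingleton.elim _ _
  · have : CompleteSpace (Matrix n n ℂ) := FiniteDimensional.complete ℂ _
    refine tendsto_pow_atTop_nhds_zero_of_spectralRadius_lt_one ?_
    exact_mod_cast spectrum.spectralRadius_lt_of_forall_lt B (r := 1) fun μ hμ => hB μ hμ

open scoped Matrix.Norms.L2Operator in
theorem posDef_one_sub_mul_transpose_of_norm_lt_one {B : Matrix n n ℝ} (hB : ‖B‖ < 1) :
    (1 - B * Bᵀ).PosDef := by
  have hherm : (1 - B * Bᵀ).IsHermitian := by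
    simp [IsHermitian, conjTranspose_eq_transpose_of_trivial]
  refine .of_dotProduct_mulVec_pos hherm fun x hx => ?_
  have hx' : 0 < ‖WithLp.toLp 2 x‖ := by simpa using hx
  have hle := l2_opNorm_mulVec Bᵀ (WithLp.toLp 2 x)
  rw [← conjTranspose_eq_transpose_of_trivial, l2_opNorm_conjTranspose] at hle
  have hlt := hle.trans_lt (mul_lt_of_lt_one_left hx' hB)
  have hsq := pow_lt_pow_left₀ hlt (norm_nonneg _) two_ne_zero
  simp only [EuclideanSpace.real_norm_sq_eq] at hsq
  rw [sub_mulVec, one_mulVec, dotProduct_sub, sub_pos, star_trivial, ← mulVec_mulVec,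
    dotProduct_mulVec, ← mulVec_transpose]
  simpa [dotProduct, sq, conjTranspose_eq_transpose_of_trivial] using hsq

theorem sum_pow_mul_transpose_sub (A : Matrix n n ℝ) (N : ℕ) :
    ∑ k ∈ Finset.range N, A ^ k * (A ^ k)ᵀ - A * (∑ k ∈ Finset.range N, A ^ k * (A ^ k)ᵀ) * Aᵀ =
      1 - A ^ N * (A ^ N)ᵀ := by
  have hstep (k : ℕ) : A * (A ^ k * (A ^ k)ᵀ) * Aᵀ = A ^ (k + 1) * (A ^ (k + 1))ᵀ := by
    rw [pow_succ' A k, transpose_mul]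
    simp only [Matrix.mul_assoc]
  simp only [Finset.mul_sum, Finset.sum_mul, hstep, ← Finset.sum_sub_distrib]
  simpa using Finset.sum_range_sub' (fun k => A ^ k * (A ^ k)ᵀ) N

theorem posDef_sum_pow_mul_transpose (A : Matrix n n ℝ) {N : ℕ} (hN : 0 < N) :
    (∑ k ∈ Finset.range N, A ^ k * (A ^ k)ᵀ).PosDef := by
  obtain ⟨M, rfl⟩ := Nat.exists_eq_succ_of_ne_zero hN.ne'
  rw [Finset.sum_range_succ']
  refine PosDef.posSemidef_add (posSemidef_sum _ fun k _ => ?_) (by simpa using PosDef.one)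
  exact posSemidef_self_mul_conjTranspose (A ^ (k + 1))

open scoped Matrix.Norms.L2Operator in
theorem exists_stein_posDef_of_forall_mem_spectrum {A : Matrix n n ℝ}
    (hA : ∀ μ ∈ spectrum ℂ (A.map Complex.ofReal), ‖μ‖ < 1) :
    ∃ U : Matrix n n ℝ, U.PosDef ∧ (U - A * U * Aᵀ).PosDef := by
  have hpow : Tendsto (fun k : ℕ => A ^ k) atTop (𝓝 0) := by
    have h := ((continuous_id.matrix_map Complex.continuous_re).tendsto 0).comp
      (tendsto_pow_atTop_nhds_zero_of_forall_mem_spectrum hA)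
    convert h using 2 with k
    · have := map_pow (RingHom.mapMatrix (m := n) Complex.ofRealHom) A k
      ext i j
      have hij := congrArg Complex.re (congrFun (congrFun this i) j)
      simpa using! hij
    · ext i j
      simp
  have hev := hpow.norm.eventually_lt_const (u := 1) (by simp)
  obtain ⟨N, hlt, hN⟩ := (hev.and (eventually_gt_atTop 0)).exists
  refine ⟨_, posDef_sum_pow_mul_transpose A hN, ?_⟩
  rw [sum_pow_mul_transpose_sub]
  exact posDef_one_sub_mul_transpose_of_norm_lt_one hlt

theorem exists_vecMul_eq_smul_of_mem_spectrum {K : Type*} [Field K] {B : Matrix n n K} {μ : K}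
    (hμ : μ ∈ spectrum K B) : ∃ v ≠ 0, v ᵥ* B = μ • v := by
  rw [spectrum.mem_iff, isUnit_iff_isUnit_det, isUnit_iff_ne_zero, not_not,
    ← exists_vecMul_eq_zero_iff] at hμ
  obtain ⟨v, hv0, hv⟩ := hμ
  refine ⟨v, hv0, ?_⟩
  rw [vecMul_sub, sub_eq_zero, algebraMap_eq_diagonal] at hv
  rw [← hv]
  ext i
  simp [vecMul_diagonal, mul_comm]

theorem norm_lt_one_of_stein_posDef {A U : Matrix n n ℝ} (hU : U.PosDef)
    (hAU : (U - A * U * Aᵀ).PosDef) {μ : ℂ} (hμ : μ ∈ spectrum ℂ (A.map Complex.ofReal)) :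
    ‖μ‖ < 1 := by
  obtain ⟨v, hv0, hv⟩ := exists_vecMul_eq_smul_of_mem_spectrum hμ
  set a : n → ℝ := fun i => (v i).re
  set b : n → ℝ := fun i => (v i).im
  have ha : a ᵥ* A = μ.re • a - μ.im • b := by
    ext j
    have := congrArg Complex.re (congrFun hv j)
    simpa [vecMul, dotProduct, a, b] using this
  have hb : b ᵥ* A = μ.re • b + μ.im • a := by
    ext j
    have := congrArg Complex.im (congrFun hv j)
    simpa [vecMul, dotProduct, a, b] using this
  have hquad (x : n → ℝ) : x ⬝ᵥ (U - A * U * Aᵀ) *ᵥ x =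
      x ⬝ᵥ U *ᵥ x - (x ᵥ* A) ⬝ᵥ U *ᵥ (x ᵥ* A) := by
    rw [sub_mulVec, dotProduct_sub, ← mulVec_mulVec, ← mulVec_mulVec, mulVec_transpose,
      dotProduct_mulVec x A]
  have hsum {M : Matrix n n ℝ} (hM : M.PosDef) : 0 < a ⬝ᵥ M *ᵥ a + b ⬝ᵥ M *ᵥ b := by
    have hnonneg (x : n → ℝ) : 0 ≤ x ⬝ᵥ M *ᵥ x := hM.posSemidef.dotProduct_mulVec_nonneg x
    by_cases ha0 : a = 0
    · have hb0 : b ≠ 0 := fun hb0 => hv0 <| funext fun i =>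
        Complex.ext (congrFun ha0 i) (congrFun hb0 i)
      exact add_pos_of_nonneg_of_pos (hnonneg a) (hM.dotProduct_mulVec_pos hb0)
    · exact add_pos_of_pos_of_nonneg (hM.dotProduct_mulVec_pos ha0) (hnonneg b)
  have hUpos := hsum hU
  have hdiff := hsum hAU
  rw [hquad, hquad, ha, hb] at hdiff
  simp only [mulVec_add, mulVec_sub, mulVec_smul, dotProduct_add, dotProduct_sub, add_dotProduct,
    sub_dotProduct, smul_dotProduct, dotProduct_smul, smul_eq_mul] at hdiff
  have hprod : 0 < (1 - ‖μ‖ ^ 2) * (a ⬝ᵥ U *ᵥ a + b ⬝ᵥ U *ᵥ b) := by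
    rw [Complex.sq_norm, Complex.normSq_apply]
    linarith
  have hsq : ‖μ‖ ^ 2 < 1 := sub_pos.mp (pos_of_mul_pos_left hprod hUpos.le)
  exact (sq_lt_one_iff₀ (norm_nonneg μ)).mp hsq

end Matrix

theorem schur_stable_iff_exists_stein_posDef {m : ℕ} (A : Matrix (Fin m) (Fin m) ℝ) :
    SchurStable A ↔
      ∃ U : Matrix (Fin m) (Fin m) ℝ, U.PosDef ∧ (U - A * U * Aᵀ).PosDef :=
  ⟨exists_stein_posDef_of_forall_mem_spectrum,
    fun ⟨_, hU, hAU⟩ _ hμ => norm_lt_one_of_stein_posDef hU hAU hμ⟩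
end

section
/- Let A₁, …, A_k be m×m real matrices. The matrix polynomial A(z) = z^k·1_m − A₁ z^{k−1} − ⋯ − A_k is Schur-stable if and only if there exist m×m real matrices U(0), U(1), …, U(k) with U(0) symmetric such that the symmetric block Toeplitz matrix U_k of order k is positive definite and the coefficients satisfy the Yule–Walker relation (A₁, …, A_k) = ξ_kᵀ U_{k−1}^{−1}. -/
open Matrix

/-- The symmetric block Toeplitz matrix with `n` block rows/columns built from the
blocks `U 0, U 1, …`: its `(i,j)` block is `U (j-i)` for `i ≤ j` and `U (i-j)ᵀ` for `i > j`. -/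
def blockToeplitz {m : ℕ} (U : ℕ → Matrix (Fin m) (Fin m) ℝ) (n : ℕ) :
    Matrix (Fin n × Fin m) (Fin n × Fin m) ℝ :=
  Matrix.of fun p q =>
    if p.1.val ≤ q.1.val then U (q.1.val - p.1.val) p.2 q.2
    else U (p.1.val - q.1.val) q.2 p.2

/-- `ξ_tᵀ = (U(1), …, U(t))`, an `m × mt` matrix. -/
def xiT {m : ℕ} (U : ℕ → Matrix (Fin m) (Fin m) ℝ) (t : ℕ) :
    Matrix (Fin m) (Fin t × Fin m) ℝ :=
  Matrix.of fun r q => U (q.1.val + 1) r q.2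

/-- `κ_tᵀ = (U(t)ᵀ, …, U(1)ᵀ)`, an `m × mt` matrix. -/
def kappaT {m : ℕ} (U : ℕ → Matrix (Fin m) (Fin m) ℝ) (t : ℕ) :
    Matrix (Fin m) (Fin t × Fin m) ℝ :=
  Matrix.of fun r q => U (t - q.1.val) q.2 r

/-- The Schur complement `C_t = U(0) - ξ_tᵀ U_{t-1}⁻¹ ξ_t` (with `C_0 = U(0)`). -/
noncomputable def schurC {m : ℕ} (U : ℕ → Matrix (Fin m) (Fin m) ℝ) (t : ℕ) :
    Matrix (Fin m) (Fin m) ℝ :=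
  U 0 - xiT U t * (blockToeplitz U t)⁻¹ * (xiT U t)ᵀ

/-- The Schur complement `D_t = U(0) - κ_tᵀ U_{t-1}⁻¹ κ_t` (with `D_0 = U(0)`). -/
noncomputable def schurD {m : ℕ} (U : ℕ → Matrix (Fin m) (Fin m) ℝ) (t : ℕ) :
    Matrix (Fin m) (Fin m) ℝ :=
  U 0 - kappaT U t * (blockToeplitz U t)⁻¹ * (kappaT U t)ᵀ

/-- The `m × mk` coefficient matrix `(A₁, …, A_k)`. -/
def coeffRow {m k : ℕ} (A : Fin k → Matrix (Fin m) (Fin m) ℝ) :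
    Matrix (Fin m) (Fin k × Fin m) ℝ :=
  Matrix.of fun r q => A q.1 r q.2

/-- The `mk × mk` companion matrix of `A₁, …, A_k`: first block row `(A₁, …, A_k)`,
identity blocks on the subdiagonal, zeros elsewhere. -/
def companion {m k : ℕ} (A : Fin k → Matrix (Fin m) (Fin m) ℝ) :
    Matrix (Fin k × Fin m) (Fin k × Fin m) ℝ :=
  Matrix.of fun p q =>
    if p.1.val = 0 then A q.1 p.2 q.2
    else if p.1.val = q.1.val + 1 then (1 : Matrix (Fin m) (Fin m) ℝ) p.2 q.2
    else 0

/-- The matrix polynomial `A(z) = z^k 1_m - A₁ z^{k-1} - ⋯ - A_k` is Schur-stable if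
every complex root of `det A(z) = 0` has modulus strictly less than one. -/
def SchurStablePoly {m k : ℕ} (A : Fin k → Matrix (Fin m) (Fin m) ℝ) : Prop :=
  ∀ z : ℂ,
    (z ^ k • (1 : Matrix (Fin m) (Fin m) ℂ) -
        ∑ i : Fin k, z ^ (k - 1 - i.val) • (A i).map Complex.ofReal).det = 0 →
    ‖z‖ < 1

section YuleWalker

namespace Matrix

section Spectral

variable {n : Type*} [Fintype n] [DecidableEq n]

attribute [local instance] Matrix.linftyOpNormedRing Matrix.linftyOpNormedAlgebra

theorem norm_entry_le_linftyOpNorm (M : Matrix n n ℂ) (i j : n) : ‖M i j‖ ≤ ‖M‖ := by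
  have h : ‖M i j‖₊ ≤ ‖M‖₊ := by
    rw [linfty_opNNNorm_def]
    exact (Finset.single_le_sum (f := fun j => ‖M i j‖₊) (fun _ _ => zero_le)
      (Finset.mem_univ j)).trans
      (Finset.le_sup (f := fun i => ∑ j, ‖M i j‖₊) (Finset.mem_univ i))
  exact h

/-- If all eigenvalues of a complex matrix lie in the open unit disc, then the entries of its
powers are absolutely summable. -/
theorem summable_norm_pow_apply_of_spectrum (M : Matrix n n ℂ)
    (hM : ∀ z ∈ spectrum ℂ M, ‖z‖ < 1) (i j : n) :
    Summable fun N : ℕ => ‖(M ^ N) i j‖ := by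
  have : Nonempty n := ⟨i⟩
  have : CompleteSpace (Matrix n n ℂ) := FiniteDimensional.complete ℂ _
  have hρ : spectralRadius ℂ M < 1 := by
    have := spectrum.spectralRadius_lt_of_forall_lt M (r := 1) (fun z hz => hM z hz)
    simpa using this
  obtain ⟨r, hr, hr1⟩ := ENNReal.lt_iff_exists_nnreal_btwn.mp hρ
  have hr1' : r < 1 := by exact_mod_cast hr1
  have hev := (spectrum.pow_nnnorm_pow_one_div_tendsto_nhds_spectralRadius M).eventually_lt_const hr
  refine Summable.of_norm_bounded_eventually_nat (g := fun N => (r : ℝ) ^ N)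
    (summable_geometric_of_lt_one r.2 hr1') ?_
  filter_upwards [hev, Filter.eventually_gt_atTop 0] with N hN hN0
  have h1 : ((‖M ^ N‖₊ : ENNReal) ^ (1 / (N : ℝ))) ^ (N : ℝ) ≤ (r : ENNReal) ^ (N : ℝ) :=
    ENNReal.rpow_le_rpow hN.le (by positivity)
  rw [← ENNReal.rpow_mul, one_div_mul_cancel (by positivity), ENNReal.rpow_one,
    ENNReal.rpow_natCast] at h1
  have h2 : ‖M ^ N‖₊ ≤ r ^ N := by exact_mod_cast h1
  rw [norm_norm]
  exact (norm_entry_le_linftyOpNorm _ i j).trans (by exact_mod_cast h2)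

end Spectral

open scoped ComplexOrder MatrixOrder in
theorem PosDef.map_ofReal {n : Type*} [Fintype n] [DecidableEq n] {M : Matrix n n ℝ}
    (hM : M.PosDef) : (M.map Complex.ofReal).PosDef := by
  obtain ⟨B, hB⟩ := CStarAlgebra.nonneg_iff_eq_star_mul_self.mp hM.posSemidef.nonneg
  have hBc : M.map Complex.ofReal = (B.map Complex.ofReal)ᴴ * B.map Complex.ofReal := by
    rw [hB, star_eq_conjTranspose]
    ext i j
    simp [Matrix.mul_apply]
  have hdet : (M.map Complex.ofReal).det ≠ 0 := by
    have h := (RingHom.map_det Complex.ofRealHom M).symm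
    rw [RingHom.mapMatrix_apply] at h
    change (M.map Complex.ofRealHom).det ≠ 0
    rw [h]
    simpa using hM.det_pos.ne'
  have hps : (M.map Complex.ofReal).PosSemidef := hBc ▸ posSemidef_conjTranspose_mul_self _
  exact hps.posDef_iff_det_ne_zero.mpr hdet

end Matrix

variable {m k : ℕ}

@[simp] theorem blockToeplitz_succ_succ (U : ℕ → Matrix (Fin m) (Fin m) ℝ) (i j : Fin k)
    (a c : Fin m) :
    blockToeplitz U (k + 1) (i.succ, a) (j.succ, c) = blockToeplitz U k (i, a) (j, c) := by
  simp [blockToeplitz]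

@[simp] theorem blockToeplitz_castSucc_castSucc (U : ℕ → Matrix (Fin m) (Fin m) ℝ)
    (i j : Fin k) (a c : Fin m) :
    blockToeplitz U (k + 1) (i.castSucc, a) (j.castSucc, c) =
      blockToeplitz U k (i, a) (j, c) := by
  simp [blockToeplitz]

@[simp] theorem blockToeplitz_zero_succ (U : ℕ → Matrix (Fin m) (Fin m) ℝ) (j : Fin k)
    (a c : Fin m) :
    blockToeplitz U (k + 1) (0, a) (j.succ, c) = xiT U k a (j, c) := by
  simp [blockToeplitz, xiT]

theorem blockToeplitz_posDef_of_succ {U : ℕ → Matrix (Fin m) (Fin m) ℝ}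
    (h : (blockToeplitz U (k + 1)).PosDef) : (blockToeplitz U k).PosDef := by
  convert h.submatrix (e := fun p : Fin k × Fin m => (p.1.succ, p.2)) ?_
  · ext p q
    simp
  · rintro ⟨i, a⟩ ⟨j, b⟩ hab
    simpa using hab

theorem coeffRow_eq_mul_inv_iff {A : Fin k → Matrix (Fin m) (Fin m) ℝ}
    {U : ℕ → Matrix (Fin m) (Fin m) ℝ} (h : (blockToeplitz U k).PosDef) :
    coeffRow A = xiT U k * (blockToeplitz U k)⁻¹ ↔
      coeffRow A * blockToeplitz U k = xiT U k := by
  have hu : IsUnit (blockToeplitz U k).det := (isUnit_iff_isUnit_det _).mp h.isUnit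
  constructor
  · intro e
    rw [e, Matrix.mul_assoc, nonsing_inv_mul _ hu, Matrix.mul_one]
  · intro e
    rw [← e, Matrix.mul_assoc, mul_nonsing_inv _ hu, Matrix.mul_one]

/-- The complexified matrix polynomial `z^k 1_m - A₁ z^{k-1} - ⋯ - A_k`. -/
noncomputable def schurPoly (A : Fin k → Matrix (Fin m) (Fin m) ℝ) (z : ℂ) :
    Matrix (Fin m) (Fin m) ℂ :=
  z ^ k • (1 : Matrix (Fin m) (Fin m) ℂ) -
    ∑ i : Fin k, z ^ (k - 1 - i.val) • (A i).map Complex.ofReal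

/-- The Horner quotients of the row vector polynomial `v A(z)`. -/
noncomputable def hornerRow (A : Fin k → Matrix (Fin m) (Fin m) ℝ) (z : ℂ) (v : Fin m → ℂ)
    (j : ℕ) : Fin m → ℂ :=
  z ^ j • v - ∑ i : Fin k,
    if i.val < j then z ^ (j - 1 - i.val) • (v ᵥ* (A i).map Complex.ofReal) else 0

theorem hornerRow_zero (A : Fin k → Matrix (Fin m) (Fin m) ℝ) (z : ℂ) (v : Fin m → ℂ) :
    hornerRow A z v 0 = v := by
  simp [hornerRow]

theorem hornerRow_succ (A : Fin k → Matrix (Fin m) (Fin m) ℝ) (z : ℂ) (v : Fin m → ℂ)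
    (j : Fin k) :
    hornerRow A z v (j + 1) = z • hornerRow A z v j - v ᵥ* (A j).map Complex.ofReal := by
  have h : ∀ i : Fin k,
      (if i.val < j.val + 1 then
        z ^ (j.val + 1 - 1 - i.val) • (v ᵥ* (A i).map Complex.ofReal) else 0) =
      z • (if i.val < j.val then
        z ^ (j.val - 1 - i.val) • (v ᵥ* (A i).map Complex.ofReal) else 0) +
      if i = j then v ᵥ* (A i).map Complex.ofReal else 0 := by
    intro i
    rcases lt_trichotomy i.val j.val with hlt | heq | hgt
    · have hne : i ≠ j := fun e => by simp [e] at hlt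
      have e : j.val + 1 - 1 - i.val = (j.val - 1 - i.val) + 1 := by omega
      simp only [hne, hlt, hlt.trans (Nat.lt_succ_self _), if_true, if_false, add_zero, e,
        pow_succ', mul_smul]
    · obtain rfl := Fin.ext heq
      simp
    · have hne : i ≠ j := fun e => by simp [e] at hgt
      have h1 : ¬ i.val < j.val := by omega
      have h2 : ¬ i.val < j.val + 1 := by omega
      simp [hne, h1, h2]
  simp only [hornerRow, h, Finset.sum_add_distrib, ← Finset.smul_sum, Finset.sum_ite_eq',
    Finset.mem_univ, if_true, pow_succ', mul_smul, smul_sub]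
  abel

theorem hornerRow_last (A : Fin k → Matrix (Fin m) (Fin m) ℝ) (z : ℂ) (v : Fin m → ℂ) :
    hornerRow A z v k = v ᵥ* schurPoly A z := by
  simp [hornerRow, schurPoly, vecMul_sub, vecMul_smul, vecMul_sum]

open scoped ComplexOrder in
theorem norm_lt_one_of_posDef_blockToeplitz {A : Fin k → Matrix (Fin m) (Fin m) ℝ}
    {U : ℕ → Matrix (Fin m) (Fin m) ℝ} (hU : (blockToeplitz U (k + 1)).PosDef)
    (hA : coeffRow A * blockToeplitz U k = xiT U k) {z : ℂ} (hz : (schurPoly A z).det = 0) :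
    ‖z‖ < 1 := by
  obtain ⟨v, hv, hvz⟩ := exists_vecMul_eq_zero_iff.mpr hz
  set w := hornerRow A z v
  have hwk : w k = 0 := (hornerRow_last A z v).trans hvz
  set M := (blockToeplitz U (k + 1)).map Complex.ofReal
  have hM : M.PosDef := hU.map_ofReal
  let x : Fin (k + 1) × Fin m → ℂ := fun p => w p.1 p.2
  let y : Fin (k + 1) × Fin m → ℂ := fun p =>
    (Fin.cons 0 (fun j : Fin k => w j) : Fin (k + 1) → Fin m → ℂ) p.1 p.2
  let u : Fin (k + 1) × Fin m → ℂ := fun p =>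
    (Fin.cons v (fun j : Fin k => - (v ᵥ* (A j).map Complex.ofReal)) :
      Fin (k + 1) → Fin m → ℂ) p.1 p.2
  have hxy : x = z • y + u := by
    ext ⟨i, a⟩
    refine Fin.cases ?_ (fun j => ?_) i
    · simp [x, y, u, w, hornerRow_zero]
    · simp [x, y, u, w, hornerRow_succ, sub_eq_add_neg]
  have hu0 : u ≠ 0 := by
    intro h
    apply hv
    ext a
    simpa [u] using congrFun h (0, a)
  have huM : ∀ (j : Fin k) (c : Fin m), (u ᵥ* M) (j.succ, c) = 0 := by
    intro j c
    have hA' : ∀ b, ∑ i : Fin k, ∑ b' : Fin m,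
        (A i b b' : ℂ) * (blockToeplitz U k (i, b') (j, c) : ℂ) = (xiT U k b (j, c) : ℂ) := by
      intro b
      rw [← hA]
      simp [Matrix.mul_apply, coeffRow, Fintype.sum_prod_type]
    have hs : ∑ i : Fin k, ∑ b' : Fin m, (v ᵥ* (A i).map Complex.ofReal) b' *
        (blockToeplitz U k (i, b') (j, c) : ℂ) = ∑ b, v b * (xiT U k b (j, c) : ℂ) := by
      simp only [← hA', vecMul, dotProduct, Finset.sum_mul, Finset.mul_sum, map_apply]
      rw [Finset.sum_congr rfl fun i _ => Finset.sum_comm, Finset.sum_comm]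
      simp only [mul_assoc]
    simp only [vecMul, dotProduct, map_apply] at hs
    simp [vecMul, dotProduct, Fintype.sum_prod_type, Fin.sum_univ_succ, u, M, hs]
  have huy : u ⬝ᵥ M *ᵥ star y = 0 := by
    rw [dotProduct_mulVec, dotProduct, Fintype.sum_prod_type, Fin.sum_univ_succ]
    simp [huM, y]
  have hyu : y ⬝ᵥ M *ᵥ star u = 0 := by
    have h := congrArg star huy
    rwa [← star_dotProduct_star, star_mulVec, star_star, hM.1.eq, ← dotProduct_mulVec,
      star_zero] at h
  have hxx : x ⬝ᵥ M *ᵥ star x = y ⬝ᵥ M *ᵥ star y := by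
    trans ∑ i : Fin k, ∑ a, w i a * ∑ j : Fin k, ∑ b,
        (blockToeplitz U k (i, a) (j, b) : ℂ) * star (w j b)
    · simp [dotProduct, mulVec, Fintype.sum_prod_type, Fin.sum_univ_castSucc (n := k), x, M, hwk]
    · simp [dotProduct, mulVec, Fintype.sum_prod_type, Fin.sum_univ_succ (n := k), y, M]
  have key : y ⬝ᵥ M *ᵥ star y =
      (z * star z) * (y ⬝ᵥ M *ᵥ star y) + u ⬝ᵥ M *ᵥ star u := by
    refine hxx.symm.trans ?_
    rw [hxy]
    simp only [star_add, star_smul, mulVec_add, mulVec_smul, add_dotProduct, dotProduct_add,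
      smul_dotProduct, dotProduct_smul, huy, hyu, smul_eq_mul]
    ring
  have hyy := hM.posSemidef.dotProduct_mulVec_nonneg (star y)
  have huu := hM.dotProduct_mulVec_pos (x := star u) (by simpa using hu0)
  rw [star_star] at hyy huu
  have hre := congrArg Complex.re key
  rw [Complex.star_def, Complex.mul_conj, Complex.add_re, Complex.re_ofReal_mul,
    Complex.normSq_eq_norm_sq] at hre
  have hyy' := (Complex.le_def.mp hyy).1
  have huu' := (Complex.lt_def.mp huu).1
  simp only [Complex.zero_re] at hyy' huu'
  by_contra! hz1
  nlinarith [mul_nonneg hyy' (sub_nonneg.mpr (one_le_pow₀ hz1 (n := 2)))]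

/-- The matrix `(1_m, 0, …, 0)ᵀ` pushed through `n` steps of the companion recursion. -/
noncomputable def impulseState (A : Fin k → Matrix (Fin m) (Fin m) ℝ) (n : ℕ) :
    Matrix (Fin k × Fin m) (Fin m) ℝ :=
  companion A ^ n *
    Matrix.of fun (p : Fin k × Fin m) b => if p.1.val = 0 ∧ p.2 = b then (1 : ℝ) else 0

/-- The impulse response `Φ₀ = 1`, `Φₙ = A₁ Φₙ₋₁ + ⋯ + A_k Φₙ₋ₖ` of the autoregression with
coefficients `A`. -/
noncomputable def impulseResponse (A : Fin k → Matrix (Fin m) (Fin m) ℝ) :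
    ℕ → Matrix (Fin m) (Fin m) ℝ
  | 0 => 1
  | n + 1 => coeffRow A * impulseState A n

/-- The impulse response at time `n - i`, which vanishes for `n < i`. -/
noncomputable def delayedResponse (A : Fin k → Matrix (Fin m) (Fin m) ℝ) (n i : ℕ) :
    Matrix (Fin m) (Fin m) ℝ :=
  if i ≤ n then impulseResponse A (n - i) else 0

@[simp] theorem delayedResponse_zero_right (A : Fin k → Matrix (Fin m) (Fin m) ℝ) (n : ℕ) :
    delayedResponse A n 0 = impulseResponse A n := by
  simp [delayedResponse]

@[simp] theorem delayedResponse_succ_succ (A : Fin k → Matrix (Fin m) (Fin m) ℝ) (n i : ℕ) :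
    delayedResponse A (n + 1) (i + 1) = delayedResponse A n i := by
  simp [delayedResponse]

@[simp] theorem delayedResponse_zero_succ (A : Fin k → Matrix (Fin m) (Fin m) ℝ) (i : ℕ) :
    delayedResponse A 0 (i + 1) = 0 := by
  simp [delayedResponse]

@[simp] theorem delayedResponse_self (A : Fin k → Matrix (Fin m) (Fin m) ℝ) (n : ℕ) :
    delayedResponse A n n = 1 := by
  simp [delayedResponse, impulseResponse]

theorem delayedResponse_of_lt (A : Fin k → Matrix (Fin m) (Fin m) ℝ) {n i : ℕ} (h : n < i) :
    delayedResponse A n i = 0 := by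
  simp [delayedResponse, h]

theorem impulseState_apply (A : Fin k → Matrix (Fin m) (Fin m) ℝ) (n : ℕ) (p : Fin k × Fin m)
    (b : Fin m) : impulseState A n p b = delayedResponse A n p.1 p.2 b := by
  induction n generalizing p with
  | zero =>
    obtain ⟨⟨i, hi⟩, a⟩ := p
    cases i <;> simp [impulseState, delayedResponse, impulseResponse, Matrix.one_apply]
  | succ n ih =>
    have hS : impulseState A (n + 1) = companion A * impulseState A n := by
      rw [impulseState, impulseState, pow_succ', Matrix.mul_assoc]
    obtain ⟨⟨i, hi⟩, a⟩ := p
    rw [hS]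
    cases i with
    | zero => simp [impulseResponse, Matrix.mul_apply, companion, coeffRow]
    | succ i =>
      rw [Matrix.mul_apply, Finset.sum_eq_single (⟨i, by omega⟩, a)]
      · simp [companion, ih]
      · rintro ⟨⟨j, hj⟩, c⟩ - hne
        have : ¬ (i = j ∧ a = c) := by
          rintro ⟨rfl, rfl⟩
          exact hne rfl
        simp only [companion, of_apply, Nat.add_eq_zero_iff, one_ne_zero, and_false, if_false,
          Nat.add_right_cancel_iff, Matrix.one_apply, mul_eq_zero]
        left
        split_ifs <;> simp_all
      · simp

theorem coeffRow_mul_delayedResponse (A : Fin k → Matrix (Fin m) (Fin m) ℝ) (n : ℕ)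
    (a b : Fin m) :
    ∑ q : Fin k × Fin m, coeffRow A a q * delayedResponse A n q.1 q.2 b =
      impulseResponse A (n + 1) a b := by
  simp only [impulseResponse, Matrix.mul_apply, impulseState_apply]

theorem norm_lt_one_of_mem_spectrum_companion {A : Fin k → Matrix (Fin m) (Fin m) ℝ}
    (hA : SchurStablePoly A) {z : ℂ}
    (hz : z ∈ spectrum ℂ ((companion A).map Complex.ofReal)) : ‖z‖ < 1 := by
  refine hA z (exists_mulVec_eq_zero_iff.mp ?_)
  rw [spectrum.mem_iff, isUnit_iff_isUnit_det, isUnit_iff_ne_zero, not_not] at hz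
  obtain ⟨y, hy, hyz⟩ := exists_mulVec_eq_zero_iff.mpr hz
  have hy' : ∀ p, ((companion A).map Complex.ofReal *ᵥ y) p = z * y p := by
    intro p
    have h := congrFun hyz p
    rw [sub_mulVec, Algebra.algebraMap_eq_smul_one, smul_mulVec, one_mulVec] at h
    exact (sub_eq_zero.mp h).symm
  obtain _ | k := k
  · exact absurd (Subsingleton.elim _ _) hy
  have hstep : ∀ (i : ℕ) (hi : i + 1 < k + 1) (a : Fin m),
      y (⟨i, by omega⟩, a) = z * y (⟨i + 1, hi⟩, a) := by
    intro i hi a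
    rw [← hy', mulVec, dotProduct, Finset.sum_eq_single (⟨i, by omega⟩, a)]
    · simp [companion]
    · rintro ⟨⟨j, hj⟩, c⟩ - hne
      have : ¬ (i = j ∧ a = c) := by
        rintro ⟨rfl, rfl⟩
        exact hne rfl
      simp only [companion, map_apply, of_apply, Nat.add_eq_zero_iff, one_ne_zero, and_false,
        if_false, Nat.add_right_cancel_iff, Matrix.one_apply, mul_eq_zero]
      left
      split_ifs <;> simp_all
    · simp
  have hpow : ∀ (l i : ℕ) (hl : i + l = k) (a : Fin m),
      y (⟨i, by omega⟩, a) = z ^ l * y (Fin.last k, a) := by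
    intro l
    induction l with
    | zero =>
      rintro i rfl a
      simp [Fin.last]
    | succ l ih =>
      intro i hl a
      rw [hstep i (by omega) a, ih (i + 1) (by omega) a, pow_succ', mul_assoc]
  refine ⟨fun a => y (Fin.last k, a), fun h => hy ?_, ?_⟩
  · ext ⟨i, a⟩
    have h0 : y (Fin.last k, a) = 0 := congrFun h a
    rw [hpow (k - i) i (by omega) a, h0, mul_zero, Pi.zero_apply]
  · ext a
    have htop := hy' (⟨0, by omega⟩, a)
    rw [hpow k 0 (by omega) a, ← mul_assoc, ← pow_succ'] at htop
    rw [sub_mulVec, smul_mulVec, one_mulVec, sum_mulVec, Pi.sub_apply, Pi.zero_apply, sub_eq_zero,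
      Pi.smul_apply, smul_eq_mul, ← htop, Finset.sum_apply]
    simp only [mulVec, dotProduct, Fintype.sum_prod_type, map_apply, companion, of_apply, if_true,
      Matrix.smul_apply, smul_eq_mul]
    refine Finset.sum_congr rfl fun i _ => Finset.sum_congr rfl fun b _ => ?_
    rw [hpow (k - i) i (by omega) b, show k + 1 - 1 - i.val = k - i by omega]
    ring

theorem summable_abs_impulseResponse {A : Fin k → Matrix (Fin m) (Fin m) ℝ}
    (hA : SchurStablePoly A) (a b : Fin m) :
    Summable fun n => |impulseResponse A n a b| := by
  have hC : ∀ p q, Summable fun n : ℕ => (companion A ^ n) p q := by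
    intro p q
    refine Summable.of_norm ?_
    convert summable_norm_pow_apply_of_spectrum _
      (fun z => norm_lt_one_of_mem_spectrum_companion hA) p q using 2 with n
    have h := (RingHom.mapMatrix (m := Fin k × Fin m) Complex.ofRealHom).map_pow (companion A) n
    change _ = ‖((RingHom.mapMatrix Complex.ofRealHom (companion A)) ^ n) p q‖
    rw [← h]
    simp
  have hS : ∀ p, Summable fun n : ℕ => impulseState A n p b := by
    intro p
    simp only [impulseState, Matrix.mul_apply]
    exact summable_sum fun q _ => (hC p q).mul_right _
  rw [summable_abs_iff, ← summable_nat_add_iff 1]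
  simp only [impulseResponse, Matrix.mul_apply]
  exact summable_sum fun q _ => (hS q).mul_left _

/-- The autocovariances of the stationary autoregression with coefficients `A` and unit noise
covariance, between the times `-i` and `-j`. -/
noncomputable def autocovariance (A : Fin k → Matrix (Fin m) (Fin m) ℝ) (i j : ℕ) :
    Matrix (Fin m) (Fin m) ℝ :=
  Matrix.of fun a c => ∑' n, ∑ b, delayedResponse A n i a b * delayedResponse A n j c b

theorem summable_abs_delayedResponse {A : Fin k → Matrix (Fin m) (Fin m) ℝ}
    (hA : SchurStablePoly A) (i : ℕ) (a b : Fin m) :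
    Summable fun n => |delayedResponse A n i a b| := by
  rw [← summable_nat_add_iff i]
  simpa [delayedResponse] using summable_abs_impulseResponse hA a b

theorem summable_delayedResponse_mul {A : Fin k → Matrix (Fin m) (Fin m) ℝ}
    (hA : SchurStablePoly A) (i j : ℕ) (a b c d : Fin m) :
    Summable fun n => delayedResponse A n i a b * delayedResponse A n j c d := by
  have h := summable_mul_of_summable_norm (f := fun n => delayedResponse A n i a b)
    (g := fun n => delayedResponse A n j c d) (summable_abs_delayedResponse hA i a b)
    (summable_abs_delayedResponse hA j c d)
  exact h.comp_injective (i := fun n : ℕ => (n, n)) fun _ _ h => (Prod.ext_iff.mp h).1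

theorem autocovariance_comm (A : Fin k → Matrix (Fin m) (Fin m) ℝ) (i j : ℕ) (a c : Fin m) :
    autocovariance A i j a c = autocovariance A j i c a := by
  simp only [autocovariance, of_apply, mul_comm]

theorem autocovariance_succ_right {A : Fin k → Matrix (Fin m) (Fin m) ℝ}
    (hA : SchurStablePoly A) (i j : ℕ) (a c : Fin m) :
    autocovariance A i (j + 1) a c =
      ∑' n, ∑ b, delayedResponse A (n + 1) i a b * delayedResponse A n j c b := by
  rw [autocovariance, of_apply,
    (summable_sum fun b _ => summable_delayedResponse_mul hA i (j + 1) a b c b).tsum_eq_zero_add]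
  simp

theorem autocovariance_succ_succ {A : Fin k → Matrix (Fin m) (Fin m) ℝ}
    (hA : SchurStablePoly A) (i j : ℕ) :
    autocovariance A (i + 1) (j + 1) = autocovariance A i j := by
  ext a c
  rw [autocovariance_succ_right hA]
  simp [autocovariance]

theorem autocovariance_add_add {A : Fin k → Matrix (Fin m) (Fin m) ℝ}
    (hA : SchurStablePoly A) (i j l : ℕ) :
    autocovariance A (i + l) (j + l) = autocovariance A i j := by
  induction l with
  | zero => rfl
  | succ l ih => rw [← add_assoc, ← add_assoc, autocovariance_succ_succ hA, ih]

theorem blockToeplitz_autocovariance {A : Fin k → Matrix (Fin m) (Fin m) ℝ}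
    (hA : SchurStablePoly A) (N : ℕ) (p q : Fin N × Fin m) :
    blockToeplitz (autocovariance A 0) N p q = autocovariance A p.1 q.1 p.2 q.2 := by
  simp only [blockToeplitz, of_apply]
  split_ifs with h
  · rw [← autocovariance_add_add hA 0 _ p.1, zero_add, Nat.sub_add_cancel h]
  · rw [← autocovariance_add_add hA 0 _ q.1, zero_add, Nat.sub_add_cancel (by omega),
      autocovariance_comm]

theorem coeffRow_mul_blockToeplitz_autocovariance {A : Fin k → Matrix (Fin m) (Fin m) ℝ}
    (hA : SchurStablePoly A) :
    coeffRow A * blockToeplitz (autocovariance A 0) k = xiT (autocovariance A 0) k := by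
  ext a ⟨j, c⟩
  have hs : ∀ q : Fin k × Fin m, Summable fun n => coeffRow A a q *
      ∑ b, delayedResponse A n q.1 q.2 b * delayedResponse A n j c b := fun q =>
    (summable_sum fun b _ => summable_delayedResponse_mul hA q.1 j q.2 b c b).mul_left _
  simp only [Matrix.mul_apply, blockToeplitz_autocovariance hA, xiT, of_apply,
    autocovariance_succ_right hA, delayedResponse_zero_right, ← coeffRow_mul_delayedResponse]
  simp only [autocovariance, of_apply, ← tsum_mul_left]
  rw [← Summable.tsum_finsetSum fun q _ => hs q]
  refine tsum_congr fun n => ?_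
  simp only [Finset.mul_sum, Finset.sum_mul]
  rw [Finset.sum_comm]
  simp only [mul_assoc]

theorem dotProduct_blockToeplitz_autocovariance {A : Fin k → Matrix (Fin m) (Fin m) ℝ}
    (hA : SchurStablePoly A) {N : ℕ} (x : Fin N × Fin m → ℝ) :
    HasSum (fun n => ∑ b, (∑ p, x p * delayedResponse A n p.1 p.2 b) ^ 2)
      (x ⬝ᵥ blockToeplitz (autocovariance A 0) N *ᵥ x) := by
  have h : HasSum (fun n => ∑ p : Fin N × Fin m, x p * ∑ q : Fin N × Fin m,
      (∑ b, delayedResponse A n p.1 p.2 b * delayedResponse A n q.1 q.2 b) * x q)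
      (x ⬝ᵥ blockToeplitz (autocovariance A 0) N *ᵥ x) := by
    refine hasSum_sum fun p _ => HasSum.mul_left _ (hasSum_sum fun q _ => HasSum.mul_right _ ?_)
    change HasSum _ (blockToeplitz (autocovariance A 0) N p q)
    rw [blockToeplitz_autocovariance hA]
    exact (summable_sum fun b _ =>
      summable_delayedResponse_mul hA p.1 q.1 p.2 b q.2 b).hasSum
  convert h using 2 with n
  simp only [sq, Finset.sum_mul_sum]
  simp only [Finset.mul_sum, Finset.sum_mul]
  rw [Finset.sum_comm]
  refine Finset.sum_congr rfl fun p _ => ?_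
  rw [Finset.sum_comm]
  exact Finset.sum_congr rfl fun q _ => Finset.sum_congr rfl fun b _ => by ring

theorem posDef_blockToeplitz_autocovariance {A : Fin k → Matrix (Fin m) (Fin m) ℝ}
    (hA : SchurStablePoly A) (N : ℕ) : (blockToeplitz (autocovariance A 0) N).PosDef := by
  refine .of_dotProduct_mulVec_pos ?_ fun x hx => ?_
  · ext p q
    simp [blockToeplitz_autocovariance hA, autocovariance_comm A q.1]
  · have hsum := dotProduct_blockToeplitz_autocovariance hA x
    have hnn : ∀ n, 0 ≤ ∑ b, (∑ p, x p * delayedResponse A n p.1 p.2 b) ^ 2 := fun n =>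
      Finset.sum_nonneg fun b _ => sq_nonneg _
    rw [star_trivial]
    refine (hsum.nonneg hnn).lt_of_ne fun h0 => hx ?_
    rw [← h0, hasSum_zero_iff_of_nonneg hnn] at hsum
    have hzero : ∀ n b, ∑ p, x p * delayedResponse A n p.1 p.2 b = 0 := by
      intro n b
      have h := (Finset.sum_eq_zero_iff_of_nonneg fun b _ => sq_nonneg _).mp (congrFun hsum n) b
        (Finset.mem_univ b)
      exact pow_eq_zero_iff two_ne_zero |>.mp h
    have hind : ∀ (n : ℕ) (hn : n < N) (b : Fin m), x (⟨n, hn⟩, b) = 0 := by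
      intro n
      induction n using Nat.strong_induction_on with
      | _ n ih =>
        intro hn b
        have h := hzero n b
        rw [Finset.sum_eq_single (⟨n, hn⟩, b)] at h
        · simpa using h
        · rintro ⟨⟨i, hi⟩, a⟩ - hne
          rcases lt_trichotomy i n with hlt | rfl | hgt
          · rw [ih i hlt hi a, zero_mul]
          · have : a ≠ b := fun e => hne (by rw [e])
            simp [this]
          · simp [delayedResponse_of_lt A hgt]
        · simp
    ext ⟨⟨i, hi⟩, a⟩
    exact hind i hi a

end YuleWalker

theorem schurStablePoly_iff_blockToeplitz {m k : ℕ}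
    (A : Fin k → Matrix (Fin m) (Fin m) ℝ) :
    SchurStablePoly A ↔
      ∃ U : ℕ → Matrix (Fin m) (Fin m) ℝ, (U 0).IsSymm ∧
        (blockToeplitz U (k + 1)).PosDef ∧
        coeffRow A = xiT U k * (blockToeplitz U k)⁻¹ := by
  constructor
  · intro hA
    refine ⟨autocovariance A 0, ?_, posDef_blockToeplitz_autocovariance hA (k + 1), ?_⟩
    · ext a c
      exact autocovariance_comm A 0 0 c a
    · rw [coeffRow_eq_mul_inv_iff (posDef_blockToeplitz_autocovariance hA k)]
      exact coeffRow_mul_blockToeplitz_autocovariance hA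
  · rintro ⟨U, -, hU, hA⟩ z hz
    rw [coeffRow_eq_mul_inv_iff (blockToeplitz_posDef_of_succ hU)] at hA
    exact norm_lt_one_of_posDef_blockToeplitz hU hA hz
end

section
/- Let A₁, …, A_k be m×m real matrices with companion matrix Ã. Suppose there exist a symmetric positive definite mk×mk real matrix U and a symmetric positive definite m×m real matrix C such that U = Ã U Ãᵀ + Ẽ, where Ẽ is the mk×mk matrix whose top-left m×m block is C and whose remaining blocks are zero. Then every eigenvalue of Ã over ℂ has modulus strictly less than 1, i.e. the matrix polynomial A(z) = z^k·1_m − A₁ z^{k−1} − ⋯ − A_k is Schur-stable. -/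
open Matrix

theorem Matrix.exists_vecMul_eq_smul_of_mem_spectrum_s11 {n K : Type*} [Fintype n] [DecidableEq n]
    [Field K] {M : Matrix n n K} {μ : K} (h : μ ∈ spectrum K M) :
    ∃ v : n → K, v ≠ 0 ∧ v ᵥ* M = μ • v := by
  rw [spectrum.mem_iff, Matrix.isUnit_iff_isUnit_det, isUnit_iff_ne_zero, not_not,
    ← Matrix.exists_vecMul_eq_zero_iff] at h
  obtain ⟨v, hv, h⟩ := h
  refine ⟨v, hv, ?_⟩
  rw [Matrix.vecMul_sub, sub_eq_zero] at h
  rw [← h, Algebra.algebraMap_eq_smul_one, Matrix.vecMul_smul, Matrix.vecMul_one]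

theorem Matrix.re_vecMul_map_ofReal {n : Type*} [Fintype n] (M : Matrix n n ℝ) (v : n → ℂ) (j : n) :
    ((v ᵥ* M.map Complex.ofReal) j).re = ((fun i => (v i).re) ᵥ* M) j := by
  simp [Matrix.vecMul, dotProduct]

theorem Matrix.im_vecMul_map_ofReal {n : Type*} [Fintype n] (M : Matrix n n ℝ) (v : n → ℂ) (j : n) :
    ((v ᵥ* M.map Complex.ofReal) j).im = ((fun i => (v i).im) ᵥ* M) j := by
  simp [Matrix.vecMul, dotProduct]

/-- A quadratic form summed over the real and imaginary parts of a complex left eigenvector of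
`M` for `μ` is scaled by `‖μ‖ ^ 2` under `U ↦ M * U * Mᵀ`. -/
theorem Matrix.dotProduct_conj_re_add_im {n : Type*} [Fintype n] (M U : Matrix n n ℝ)
    {v : n → ℂ} {μ : ℂ} (h : v ᵥ* M.map Complex.ofReal = μ • v) :
    (fun i => (v i).re) ⬝ᵥ ((M * U * Mᵀ) *ᵥ fun i => (v i).re) +
      (fun i => (v i).im) ⬝ᵥ ((M * U * Mᵀ) *ᵥ fun i => (v i).im) =
    ‖μ‖ ^ 2 * ((fun i => (v i).re) ⬝ᵥ (U *ᵥ fun i => (v i).re) +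
      (fun i => (v i).im) ⬝ᵥ (U *ᵥ fun i => (v i).im)) := by
  have hre : (fun i => (v i).re) ᵥ* M =
      μ.re • (fun i => (v i).re) - μ.im • (fun i => (v i).im) := by
    ext j
    simp [← Matrix.re_vecMul_map_ofReal, h]
  have him : (fun i => (v i).im) ᵥ* M =
      μ.re • (fun i => (v i).im) + μ.im • (fun i => (v i).re) := by
    ext j
    simp [← Matrix.im_vecMul_map_ofReal, h]
  have hconj (x : n → ℝ) :
      x ⬝ᵥ ((M * U * Mᵀ) *ᵥ x) = (x ᵥ* M) ⬝ᵥ (U *ᵥ (x ᵥ* M)) := by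
    rw [← Matrix.mulVec_mulVec, ← Matrix.mulVec_mulVec, Matrix.mulVec_transpose,
      Matrix.dotProduct_mulVec]
  rw [hconj, hconj, hre, him, Complex.sq_norm, Complex.normSq_apply]
  simp only [Matrix.mulVec_add, Matrix.mulVec_sub, Matrix.mulVec_smul, add_dotProduct,
    sub_dotProduct, dotProduct_add, dotProduct_sub, smul_dotProduct, dotProduct_smul, smul_eq_mul]
  ring

theorem dotProduct_topLeftBlock_mulVec {m k : ℕ} (C : Matrix (Fin m) (Fin m) ℝ)
    (x : Fin (k + 1) × Fin m → ℝ) :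
    x ⬝ᵥ ((Matrix.of fun p q : Fin (k + 1) × Fin m =>
      if p.1.val = 0 ∧ q.1.val = 0 then C p.2 q.2 else 0) *ᵥ x) =
    (fun s => x (0, s)) ⬝ᵥ (C *ᵥ fun s => x (0, s)) := by
  simp [dotProduct, Matrix.mulVec, Fintype.sum_prod_type, Fin.sum_univ_succ]

/-- A left eigenvector of the companion matrix is determined by its first block. -/
theorem eq_zero_of_vecMul_companion {m k : ℕ} {A : Fin (k + 1) → Matrix (Fin m) (Fin m) ℝ}
    {v : Fin (k + 1) × Fin m → ℂ} {μ : ℂ}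
    (h : v ᵥ* (companion A).map Complex.ofReal = μ • v) (h0 : ∀ s, v (0, s) = 0) : v = 0 := by
  suffices ∀ i s, v (i, s) = 0 from funext fun p => this p.1 p.2
  intro i
  induction i using Fin.induction with
  | zero => exact h0
  | succ i ih =>
    intro s
    have := congrFun h (i.castSucc, s)
    simpa [Matrix.vecMul, dotProduct, companion, Fintype.sum_prod_type, Fin.sum_univ_succ, h0, ih,
      Matrix.one_apply, Fin.val_inj, ite_and, apply_ite Complex.ofReal] using this

theorem companion_stable_of_stein_posDef {m k : ℕ}
    (A : Fin k → Matrix (Fin m) (Fin m) ℝ)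
    (U : Matrix (Fin k × Fin m) (Fin k × Fin m) ℝ) (C : Matrix (Fin m) (Fin m) ℝ)
    (hU : U.PosDef) (hC : C.PosDef)
    (hric : U = companion A * U * (companion A)ᵀ +
      Matrix.of fun p q => if p.1.val = 0 ∧ q.1.val = 0 then C p.2 q.2 else 0) :
    ∀ μ ∈ spectrum ℂ (((companion A)).map Complex.ofReal), ‖μ‖ < 1 := by
  intro μ hμ
  obtain ⟨v, hv, h⟩ := Matrix.exists_vecMul_eq_smul_of_mem_spectrum_s11 hμ
  cases k with
  | zero => exact absurd (Subsingleton.elim v 0) hv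
  | succ k =>
    set x : Fin (k + 1) × Fin m → ℝ := fun i => (v i).re
    set y : Fin (k + 1) × Fin m → ℝ := fun i => (v i).im
    have key := Matrix.dotProduct_conj_re_add_im (companion A) U h
    have hform (w : Fin (k + 1) × Fin m → ℝ) : w ⬝ᵥ (U *ᵥ w) =
        w ⬝ᵥ ((companion A * U * (companion A)ᵀ) *ᵥ w) +
          (fun s => w (0, s)) ⬝ᵥ (C *ᵥ fun s => w (0, s)) := by
      conv_lhs => rw [hric]
      rw [Matrix.add_mulVec, dotProduct_add, dotProduct_topLeftBlock_mulVec]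
    have hUx : 0 ≤ x ⬝ᵥ (U *ᵥ x) := by simpa using hU.posSemidef.dotProduct_mulVec_nonneg x
    have hUy : 0 ≤ y ⬝ᵥ (U *ᵥ y) := by simpa using hU.posSemidef.dotProduct_mulVec_nonneg y
    have hfx := hform x
    have hfy := hform y
    by_contra! hμ1
    have hsq : 1 ≤ ‖μ‖ ^ 2 := one_le_pow₀ hμ1
    have hle := le_mul_of_one_le_left (add_nonneg hUx hUy) hsq
    have hCpos {w : Fin m → ℝ} (hw : w ≠ 0) : 0 < w ⬝ᵥ (C *ᵥ w) := by
      simpa using hC.dotProduct_mulVec_pos hw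
    have hCnonneg (w : Fin m → ℝ) : 0 ≤ w ⬝ᵥ (C *ᵥ w) := by
      simpa using hC.posSemidef.dotProduct_mulVec_nonneg w
    have hCx := hCnonneg fun s => x (0, s)
    have hCy := hCnonneg fun s => y (0, s)
    have hx0 : (fun s => x (0, s)) = 0 := by
      by_contra hne
      linarith [hCpos hne]
    have hy0 : (fun s => y (0, s)) = 0 := by
      by_contra hne
      linarith [hCpos hne]
    exact hv (eq_zero_of_vecMul_companion h fun s =>
      Complex.ext (congrFun hx0 s) (congrFun hy0 s))
end

section
/- Let U_{k−1} be a symmetric block Toeplitz matrix of order k−1 with m×m blocks U(0), …, U(k−1), let A₁, …, A_k be m×m real matrices with companion matrix Ã, and set S̃ := U_{k−1} − Ã U_{k−1} Ãᵀ. Then for all 2 ≤ i, j ≤ k the (i,j) m×m block of S̃ is zero. Consequently, if S̃ is positive semidefinite, then S̃ equals the mk×mk matrix whose top-left m×m block is U(0) − A U_{k−1} Aᵀ (where A = (A₁, …, A_k) is the m×mk coefficient matrix) and whose remaining blocks are all zero. -/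
open Matrix

/-- Left multiplication by the companion matrix replaces the block row `i > 0` by its
predecessor. -/
theorem companion_mul_apply_of_pos {m k : ℕ} {n : Type*}
    (A : Fin k → Matrix (Fin m) (Fin m) ℝ) (M : Matrix (Fin k × Fin m) n ℝ)
    (i i' : Fin k) (hi : i.val = i'.val + 1) (r : Fin m) (q : n) :
    (companion A * M) (i, r) q = M (i', r) q := by
  rw [Matrix.mul_apply, Finset.sum_eq_single (i', r)]
  · simp [companion, hi]
  · rintro ⟨j, c⟩ - hne
    have h0 : i.val ≠ 0 := by omega
    by_cases hj : i.val = j.val + 1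
    · have hji : j = i' := Fin.ext (by omega)
      subst hji
      have hc : r ≠ c := by
        rintro rfl
        exact hne rfl
      simp [companion, hi, Matrix.one_apply_ne hc]
    · simp [companion, h0, hj]
  · simp

/-- The block row `0` of a product with the companion matrix is given by the coefficient row. -/
theorem companion_mul_apply_of_eq_zero {m k : ℕ} {n : Type*}
    (A : Fin k → Matrix (Fin m) (Fin m) ℝ) (M : Matrix (Fin k × Fin m) n ℝ)
    (i : Fin k) (hi : i.val = 0) (r : Fin m) (q : n) :
    (companion A * M) (i, r) q = (coeffRow A * M) r q := by
  simp [Matrix.mul_apply, companion, coeffRow, hi]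

theorem mul_companion_transpose_apply {m k : ℕ} {n : Type*}
    (A : Fin k → Matrix (Fin m) (Fin m) ℝ) (M : Matrix n (Fin k × Fin m) ℝ)
    (p : n) (q : Fin k × Fin m) :
    (M * (companion A)ᵀ) p q = (companion A * Mᵀ) q p := by
  rw [← Matrix.transpose_apply (M * _), Matrix.transpose_mul, Matrix.transpose_transpose]

theorem stein_apply_eq_zero_of_pos {m k : ℕ} (U : ℕ → Matrix (Fin m) (Fin m) ℝ)
    (A : Fin k → Matrix (Fin m) (Fin m) ℝ) (i j : Fin k) (hi : 0 < i.val) (hj : 0 < j.val)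
    (r c : Fin m) :
    (blockToeplitz U k - companion A * blockToeplitz U k * (companion A)ᵀ) (i, r) (j, c)
      = 0 := by
  let i' : Fin k := ⟨i.val - 1, by omega⟩
  let j' : Fin k := ⟨j.val - 1, by omega⟩
  have hi' : i.val = i'.val + 1 := by simp only [i']; omega
  have hj' : j.val = j'.val + 1 := by simp only [j']; omega
  rw [Matrix.sub_apply, mul_companion_transpose_apply, companion_mul_apply_of_pos A _ j j' hj',
    Matrix.transpose_apply, companion_mul_apply_of_pos A _ i i' hi']
  simp only [blockToeplitz, Matrix.of_apply, hi', hj', Nat.add_le_add_iff_right,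
    Nat.add_sub_add_right, sub_self]

theorem stein_apply_of_eq_zero {m k : ℕ} (U : ℕ → Matrix (Fin m) (Fin m) ℝ)
    (A : Fin k → Matrix (Fin m) (Fin m) ℝ) (i j : Fin k) (hi : i.val = 0) (hj : j.val = 0)
    (r c : Fin m) :
    (blockToeplitz U k - companion A * blockToeplitz U k * (companion A)ᵀ) (i, r) (j, c)
      = (U 0 - coeffRow A * blockToeplitz U k * (coeffRow A)ᵀ) r c := by
  rw [Matrix.sub_apply, Matrix.sub_apply, mul_companion_transpose_apply,
    companion_mul_apply_of_eq_zero A _ j hj]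
  congr 1
  · simp only [blockToeplitz, Matrix.of_apply, hi, hj, le_refl, if_true, Nat.sub_self]
  · simp only [Matrix.mul_apply (M := coeffRow A) (N := (companion A * _)ᵀ),
      Matrix.mul_apply (N := (coeffRow A)ᵀ), Matrix.transpose_apply,
      companion_mul_apply_of_eq_zero A _ i hi]
    exact Finset.sum_congr rfl fun _ _ => mul_comm _ _

/-- A real positive semidefinite matrix with a vanishing diagonal entry has a vanishing
column there. -/
theorem Matrix.PosSemidef.apply_eq_zero_of_diag_eq_zero {n : Type*}
    {M : Matrix n n ℝ} (hM : M.PosSemidef) {q : n} (hq : M q q = 0) (p : n) :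
    M p q = 0 := by
  have hsymm : M q p = M p q := by simpa using hM.1.apply p q
  have hdet := (hM.submatrix ![p, q]).det_nonneg
  simp only [Matrix.det_fin_two, Matrix.submatrix_apply, Matrix.cons_val_zero,
    Matrix.cons_val_one, hq, hsymm] at hdet
  nlinarith [mul_self_nonneg (M p q)]

theorem generalized_stein_block_structure {m k : ℕ}
    (U : ℕ → Matrix (Fin m) (Fin m) ℝ) (hsymm : (U 0).IsSymm)
    (A : Fin k → Matrix (Fin m) (Fin m) ℝ) :
    (∀ (i j : Fin k), 0 < i.val → 0 < j.val → ∀ (r c : Fin m),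
      (blockToeplitz U k - companion A * blockToeplitz U k * (companion A)ᵀ) (i, r) (j, c)
        = 0) ∧
    ((blockToeplitz U k - companion A * blockToeplitz U k * (companion A)ᵀ).PosSemidef →
      blockToeplitz U k - companion A * blockToeplitz U k * (companion A)ᵀ =
        Matrix.of fun p q =>
          if p.1.val = 0 ∧ q.1.val = 0 then
            (U 0 - coeffRow A * blockToeplitz U k * (coeffRow A)ᵀ) p.2 q.2
          else 0) := by
  refine ⟨stein_apply_eq_zero_of_pos U A, fun hS => ?_⟩
  ext ⟨i, r⟩ ⟨j, c⟩
  simp only [Matrix.of_apply]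
  split_ifs with h
  · exact stein_apply_of_eq_zero U A i j h.1 h.2 r c
  · by_cases hj : j.val = 0
    · have hi : 0 < i.val := Nat.pos_of_ne_zero fun hi => h ⟨hi, hj⟩
      have hzero := hS.apply_eq_zero_of_diag_eq_zero
        (stein_apply_eq_zero_of_pos U A i i hi hi r r) (j, c)
      rw [← hS.1.apply, hzero, star_zero]
    · have hj := Nat.pos_of_ne_zero hj
      exact hS.apply_eq_zero_of_diag_eq_zero (stein_apply_eq_zero_of_pos U A j j hj hj c c) (i, r)
end

section
/- Let A be a Schur-stable m×m real matrix and M a symmetric positive definite m×m real matrix. Then the series U := Σ_{j≥0} Aʲ M (Aᵀ)ʲ converges, U is symmetric positive definite, U ≥_L M, and U − A U Aᵀ = M. -/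
open Matrix

open Filter Topology in
/-- If the spectrum of `a` lies in the open unit disc, then the powers of `a` eventually decay
geometrically. -/
theorem exists_eventually_norm_pow_le {R : Type*} [NormedRing R] [NormedAlgebra ℂ R]
    [CompleteSpace R] (a : R) (ha : ∀ z ∈ spectrum ℂ a, ‖z‖ < 1) :
    ∃ r : ℝ, 0 ≤ r ∧ r < 1 ∧ ∀ᶠ n : ℕ in atTop, ‖a ^ n‖ ≤ r ^ n := by
  have hρ : spectralRadius ℂ a < 1 := by
    rcases subsingleton_or_nontrivial R with h | h
    · simp [spectralRadius, spectrum.of_subsingleton]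
    · exact_mod_cast spectrum.spectralRadius_lt_of_forall_lt a (r := 1) fun z hz => ha z hz
  obtain ⟨r, hr, hr1⟩ := ENNReal.lt_iff_exists_nnreal_btwn.mp hρ
  refine ⟨r, r.2, by exact_mod_cast hr1, ?_⟩
  filter_upwards [(spectrum.pow_nnnorm_pow_one_div_tendsto_nhds_spectralRadius a).eventually_lt_const
    hr, eventually_gt_atTop 0] with n hn hn0
  have h := pow_le_pow_left₀ zero_le hn.le n
  rw [← ENNReal.rpow_natCast, ← ENNReal.rpow_mul, one_div,
    inv_mul_cancel₀ (by positivity), ENNReal.rpow_one] at h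
  exact_mod_cast h

open scoped Matrix.Norms.Frobenius in
theorem SchurStable.summable {m : ℕ} {A : Matrix (Fin m) (Fin m) ℝ} (hA : SchurStable A)
    (M : Matrix (Fin m) (Fin m) ℝ) : Summable (fun j : ℕ => A ^ j * M * Aᵀ ^ j) := by
  have : CompleteSpace (Matrix (Fin m) (Fin m) ℂ) := FiniteDimensional.complete ℂ _
  have : CompleteSpace (Matrix (Fin m) (Fin m) ℝ) := FiniteDimensional.complete ℝ _
  obtain ⟨r, hr0, hr1, hr⟩ := exists_eventually_norm_pow_le (A.map Complex.ofReal) hA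
  have hs : Summable fun j : ℕ => ‖M‖ * (r ^ 2) ^ j :=
    (summable_geometric_of_lt_one (by positivity) (by nlinarith)).mul_left _
  refine hs.of_norm_bounded_eventually_nat ?_
  filter_upwards [hr] with n hn
  have hmap : A.map Complex.ofReal ^ n = (A ^ n).map Complex.ofReal :=
    (map_pow Complex.ofRealHom.mapMatrix A n).symm
  rw [hmap, frobenius_norm_map_eq _ _ Complex.norm_real] at hn
  calc ‖A ^ n * M * Aᵀ ^ n‖ ≤ ‖A ^ n‖ * ‖M‖ * ‖A ^ n‖ := by
        rw [← transpose_pow]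
        refine (norm_mul_le _ _).trans ?_
        rw [frobenius_norm_transpose]
        gcongr
        exact norm_mul_le _ _
    _ ≤ r ^ n * ‖M‖ * r ^ n := by gcongr
    _ = ‖M‖ * (r ^ 2) ^ n := by ring

theorem Matrix.PosSemidef.tsum {ι n : Type*} [Fintype n] {f : ι → Matrix n n ℝ}
    (hs : Summable f) (hf : ∀ i, (f i).PosSemidef) : (∑' i, f i).PosSemidef := by
  refine .of_dotProduct_mulVec_nonneg ?_ fun x => ?_
  · rw [IsHermitian, conjTranspose_tsum]
    exact tsum_congr fun i => (hf i).isHermitian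
  · let φ : Matrix n n ℝ →+ ℝ :=
      { toFun := fun B => star x ⬝ᵥ B *ᵥ x
        map_zero' := by simp
        map_add' := fun B C => by simp [add_mulVec] }
    have hφ : Continuous φ := by
      change Continuous fun B : Matrix n n ℝ => star x ⬝ᵥ B *ᵥ x
      fun_prop
    exact (hs.hasSum.map φ hφ).nonneg fun i => (hf i).dotProduct_mulVec_nonneg x

theorem series_solution_of_stein_equation {m : ℕ} (A M : Matrix (Fin m) (Fin m) ℝ)
    (hA : SchurStable A) (hM : M.PosDef) :
    Summable (fun j : ℕ => A ^ j * M * Aᵀ ^ j) ∧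
    (∑' j : ℕ, A ^ j * M * Aᵀ ^ j).PosDef ∧
    ((∑' j : ℕ, A ^ j * M * Aᵀ ^ j) - M).PosSemidef ∧
    (∑' j : ℕ, A ^ j * M * Aᵀ ^ j) - A * (∑' j : ℕ, A ^ j * M * Aᵀ ^ j) * Aᵀ = M := by
  have hs := hA.summable M
  have hU : (∑' j : ℕ, A ^ j * M * Aᵀ ^ j).PosSemidef := .tsum hs fun j => by
    simpa [conjTranspose_eq_transpose_of_trivial, transpose_pow] using
      hM.posSemidef.mul_mul_conjTranspose_same (A ^ j)
  have hstein : (∑' j : ℕ, A ^ j * M * Aᵀ ^ j) =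
      M + A * (∑' j : ℕ, A ^ j * M * Aᵀ ^ j) * Aᵀ := by
    conv_lhs => rw [hs.tsum_eq_zero_add]
    rw [← hs.tsum_mul_left, ← (hs.mul_left A).tsum_mul_right]
    congr 1
    · simp
    · exact tsum_congr fun j => by rw [pow_succ', pow_succ]; simp only [mul_assoc]
  have hrest : (A * (∑' j : ℕ, A ^ j * M * Aᵀ ^ j) * Aᵀ).PosSemidef := by
    simpa [conjTranspose_eq_transpose_of_trivial] using hU.mul_mul_conjTranspose_same A
  refine ⟨hs, ?_, ?_, sub_eq_of_eq_add hstein⟩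
  · rw [hstein]
    exact hM.add_posSemidef hrest
  · rwa [sub_eq_of_eq_add' hstein]
end

section
/- Let A₁, …, A_k be m×m real matrices whose matrix polynomial A(z) = z^k·1_m − A₁ z^{k−1} − ⋯ − A_k is Schur-stable, let Ã be the companion matrix, let M be a symmetric positive definite m×m real matrix, and let Ẽ be the mk×mk matrix whose top-left m×m block is M and whose remaining blocks are zero. Then the series U := Σ_{j≥0} Ãʲ Ẽ (Ãᵀ)ʲ converges, satisfies U = Ã U Ãᵀ + Ẽ, is a symmetric block Toeplitz matrix of order k−1 (i.e. there exist m×m matrices U(0), …, U(k−1), U(0) symmetric, whose associated block Toeplitz matrix equals U), and U is positive definite. -/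
open Matrix

open Filter
open scoped NNReal ENNReal

/-- In a complex Banach algebra, the powers of an element whose spectrum lies in the open unit
disc decay geometrically. -/
theorem exists_norm_pow_le_of_forall_spectrum_lt {R : Type*} [NormedRing R] [NormedAlgebra ℂ R]
    [CompleteSpace R] [Nontrivial R] (a : R) (ha : ∀ z ∈ spectrum ℂ a, ‖z‖ < 1) :
    ∃ r : ℝ, 0 ≤ r ∧ r < 1 ∧ ∀ᶠ n : ℕ in atTop, ‖a ^ n‖ ≤ r ^ n := by
  have hρ : spectralRadius ℂ a < ((1 : ℝ≥0) : ℝ≥0∞) :=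
    spectrum.spectralRadius_lt_of_forall_lt a fun z hz => by exact_mod_cast ha z hz
  obtain ⟨r, hr, hr1⟩ := ENNReal.lt_iff_exists_nnreal_btwn.mp hρ
  refine ⟨r, r.2, by exact_mod_cast hr1, ?_⟩
  filter_upwards [(spectrum.pow_nnnorm_pow_one_div_tendsto_nhds_spectralRadius a).eventually_lt_const
    hr, eventually_gt_atTop 0] with n hn hn0
  have hn' : (0 : ℝ) < n := by exact_mod_cast hn0
  have h := ENNReal.rpow_le_rpow hn.le hn'.le
  rw [← ENNReal.rpow_mul, one_div, inv_mul_cancel₀ hn'.ne', ENNReal.rpow_one,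
    ENNReal.rpow_natCast] at h
  exact_mod_cast h

section Frobenius

attribute [local instance] Matrix.frobeniusNormedRing Matrix.frobeniusNormedAlgebra

/-- If all complex eigenvalues of a real matrix `A` lie in the open unit disc, then the series
`∑ⱼ Aʲ E (Aᵀ)ʲ` converges. -/
theorem summable_pow_mul_mul_transpose_pow {n : Type*} [Fintype n] [DecidableEq n]
    (A E : Matrix n n ℝ)
    (hA : ∀ (z : ℂ) (v : n → ℂ), v ≠ 0 → A.map Complex.ofReal *ᵥ v = z • v → ‖z‖ < 1) :
    Summable fun j : ℕ => A ^ j * E * Aᵀ ^ j := by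
  cases isEmpty_or_nonempty n
  · exact (summable_zero (α := Matrix n n ℝ)).congr fun _ => Subsingleton.elim _ _
  have : CompleteSpace (Matrix n n ℂ) := FiniteDimensional.complete ℂ _
  have : CompleteSpace (Matrix n n ℝ) := FiniteDimensional.complete ℝ _
  obtain ⟨r, hr0, hr1, hr⟩ :=
    exists_norm_pow_le_of_forall_spectrum_lt (A.map Complex.ofReal) (by
      intro z hz
      rw [← Matrix.spectrum_toLin', ← Module.End.hasEigenvalue_iff_mem_spectrum] at hz
      obtain ⟨v, hv⟩ := hz.exists_hasEigenvector
      exact hA z v hv.2 (by simpa using hv.apply_eq_smul))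
  have hnorm (j : ℕ) : ‖A ^ j‖ = ‖A.map Complex.ofReal ^ j‖ := by
    have h : A.map Complex.ofReal ^ j = (A ^ j).map Complex.ofReal :=
      (map_pow (Complex.ofRealHom.mapMatrix (m := n)) A j).symm
    rw [h, Matrix.frobenius_norm_map_eq _ _ fun a => Complex.norm_real a]
  have hr2 : r ^ 2 < 1 := by nlinarith
  refine Summable.of_norm_bounded_eventually_nat
    ((summable_geometric_of_lt_one (sq_nonneg r) hr2).mul_right ‖E‖) ?_
  filter_upwards [hr] with j hj
  rw [← hnorm] at hj
  calc ‖A ^ j * E * Aᵀ ^ j‖ ≤ ‖A ^ j‖ * ‖E‖ * ‖Aᵀ ^ j‖ :=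
        (norm_mul_le _ _).trans (by gcongr; exact norm_mul_le _ _)
    _ = ‖A ^ j‖ * ‖E‖ * ‖A ^ j‖ := by
        rw [← Matrix.transpose_pow, Matrix.frobenius_norm_transpose]
    _ ≤ r ^ j * ‖E‖ * r ^ j := by gcongr
    _ = (r ^ 2) ^ j * ‖E‖ := by ring

end Frobenius

theorem companion_zero_apply {m k : ℕ} (A : Fin (k + 1) → Matrix (Fin m) (Fin m) ℝ)
    (r : Fin m) (q : Fin (k + 1) × Fin m) : companion A (0, r) q = A q.1 r q.2 := by
  simp [companion]

theorem companion_succ_apply {m k : ℕ} (A : Fin (k + 1) → Matrix (Fin m) (Fin m) ℝ)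
    (i : Fin k) (r : Fin m) (q : Fin (k + 1) × Fin m) :
    companion A (i.succ, r) q = if q = (i.castSucc, r) then 1 else 0 := by
  obtain ⟨j, s⟩ := q
  by_cases h : j = i.castSucc
  · subst h
    simp [companion, Matrix.one_apply, eq_comm]
  · have h' : i.val ≠ j.val := fun e => h (Fin.ext e.symm)
    simp [companion, h, h']

/-- Eigenvalues of the companion matrix of a Schur-stable polynomial lie in the open unit disc. -/
theorem SchurStablePoly.norm_lt_one_of_companion_mulVec {m k : ℕ}
    {A : Fin k → Matrix (Fin m) (Fin m) ℝ} (hA : SchurStablePoly A) (z : ℂ)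
    (v : Fin k × Fin m → ℂ) (hv : v ≠ 0)
    (h : (companion A).map Complex.ofReal *ᵥ v = z • v) : ‖z‖ < 1 := by
  rcases k with _ | k
  · exact (hv (Subsingleton.elim _ _)).elim
  have hstep (i : Fin k) (r : Fin m) : v (i.castSucc, r) = z * v (i.succ, r) := by
    have := congrFun h (i.succ, r)
    simpa [Matrix.mulVec, dotProduct, companion_succ_apply, apply_ite Complex.ofReal] using this
  have hlast (i : Fin (k + 1)) (r : Fin m) :
      v (i, r) = z ^ (k - i.val) * v (Fin.last k, r) := by
    induction i using Fin.reverseInduction with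
    | last => simp
    | cast i ih =>
      rw [hstep, ih, ← mul_assoc, ← pow_succ']
      congr 2
      simp only [Fin.val_succ, Fin.val_castSucc]
      omega
  refine hA z (Matrix.exists_mulVec_eq_zero_iff.mp ⟨fun r => v (Fin.last k, r), ?_, ?_⟩)
  · intro h0
    refine hv (funext fun p => ?_)
    rw [← Prod.mk.eta (p := p), hlast, congrFun h0 p.2]
    simp
  · funext r
    have h0 := congrFun h (0, r)
    simp only [Matrix.mulVec, dotProduct, Matrix.map_apply, companion_zero_apply,
      Fintype.sum_prod_type, Pi.smul_apply, smul_eq_mul] at h0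
    rw [hlast 0] at h0
    simp only [Matrix.sub_mulVec, Matrix.smul_mulVec, Matrix.one_mulVec, Matrix.sum_mulVec,
      Pi.sub_apply, Pi.smul_apply, Finset.sum_apply, smul_eq_mul, Pi.zero_apply]
    rw [sub_eq_zero, pow_succ', mul_assoc]
    refine h0.symm.trans (Finset.sum_congr rfl fun i _ => ?_)
    simp only [Matrix.mulVec, dotProduct, Matrix.map_apply, Finset.mul_sum]
    refine Finset.sum_congr rfl fun s _ => ?_
    rw [hlast]
    simp only [Nat.add_sub_cancel]
    ring

/-- A symmetric solution of `S = Ã S Ãᵀ + E`, with `E` supported in the top-left block, is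
block Toeplitz. -/
theorem exists_eq_blockToeplitz_of_stein {m k : ℕ} {A : Fin k → Matrix (Fin m) (Fin m) ℝ}
    {S E : Matrix (Fin k × Fin m) (Fin k × Fin m) ℝ} (hS : S.IsSymm)
    (hE : ∀ p q, p.1.val ≠ 0 → E p q = 0)
    (h : S = companion A * S * (companion A)ᵀ + E) :
    ∃ U : ℕ → Matrix (Fin m) (Fin m) ℝ, (U 0).IsSymm ∧ S = blockToeplitz U k := by
  rcases k with _ | k
  · exact ⟨0, Matrix.isSymm_zero, Subsingleton.elim _ _⟩
  have hshift (i j : Fin k) (r s : Fin m) :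
      S (i.succ, r) (j.succ, s) = S (i.castSucc, r) (j.castSucc, s) := by
    have := congrFun (congrFun h (i.succ, r)) (j.succ, s)
    rw [Matrix.add_apply, hE _ _ (by simp), add_zero] at this
    simpa [Matrix.mul_apply, companion_succ_apply] using this
  have hU (i j : ℕ) (hi : i + j < k + 1) (r s : Fin m) :
      S (⟨i, by omega⟩, r) (⟨i + j, hi⟩, s) = S (0, r) (⟨j, by omega⟩, s) := by
    induction i with
    | zero => simp
    | succ i ih =>
      rw [← ih (by omega)]
      refine Eq.trans ?_ (hshift ⟨i, by omega⟩ ⟨i + j, by omega⟩ r s)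
      congr 3
      omega
  refine ⟨fun n => Matrix.of fun r s => if hn : n < k + 1 then S (0, r) (⟨n, hn⟩, s) else 0,
    ?_, ?_⟩
  · ext r s
    simpa using hS.apply (0, r) (0, s)
  · ext ⟨i, r⟩ ⟨j, s⟩
    simp only [blockToeplitz, Matrix.of_apply]
    split_ifs with hij h1 h1
    · rw [← hU i (j - i) (by omega)]
      congr 3
      ext
      simp only
      omega
    · omega
    · rw [← hU j (i - j) (by omega), ← hS.apply]
      congr 3
      ext
      simp only
      omega
    · omega

/-- A positive semidefinite solution of `S = Ã S Ãᵀ + E`, where the quadratic form of `E` is that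
of a positive definite matrix on the first block, is positive definite. -/
theorem posDef_of_stein {m k : ℕ} {A : Fin (k + 1) → Matrix (Fin m) (Fin m) ℝ}
    {S E : Matrix (Fin (k + 1) × Fin m) (Fin (k + 1) × Fin m) ℝ} {M : Matrix (Fin m) (Fin m) ℝ}
    (hM : M.PosDef) (hS : S.PosSemidef)
    (hE : ∀ x, x ⬝ᵥ E *ᵥ x = (fun r => x (0, r)) ⬝ᵥ M *ᵥ fun r => x (0, r))
    (h : S = companion A * S * (companion A)ᵀ + E) : S.PosDef := by
  have hquad (x) : x ⬝ᵥ S *ᵥ x = ((companion A)ᵀ *ᵥ x) ⬝ᵥ S *ᵥ ((companion A)ᵀ *ᵥ x) +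
      (fun r => x (0, r)) ⬝ᵥ M *ᵥ fun r => x (0, r) := by
    conv_lhs => rw [h]
    rw [Matrix.add_mulVec, dotProduct_add, hE, ← Matrix.mulVec_mulVec, ← Matrix.mulVec_mulVec,
      Matrix.dotProduct_mulVec, ← Matrix.mulVec_transpose]
  have hnn (x) : 0 ≤ x ⬝ᵥ S *ᵥ x := by simpa using hS.dotProduct_mulVec_nonneg x
  have hMnn (y) : 0 ≤ y ⬝ᵥ M *ᵥ y := by simpa using hM.posSemidef.dotProduct_mulVec_nonneg y
  have hzero (x) (hx : x ⬝ᵥ S *ᵥ x = 0) :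
      ((companion A)ᵀ *ᵥ x) ⬝ᵥ S *ᵥ ((companion A)ᵀ *ᵥ x) = 0 ∧ ∀ r, x (0, r) = 0 := by
    have h1 := hnn ((companion A)ᵀ *ᵥ x)
    have h2 := hMnn fun r => x (0, r)
    have h3 := hquad x
    refine ⟨by linarith, fun r => ?_⟩
    by_contra hr
    have := hM.dotProduct_mulVec_pos (x := fun r => x (0, r)) fun h0 => hr (congrFun h0 r)
    simp only [star_trivial] at this
    linarith
  have hker (i : Fin (k + 1)) : ∀ x, x ⬝ᵥ S *ᵥ x = 0 → ∀ r, x (i, r) = 0 := by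
    induction i using Fin.induction with
    | zero => exact fun x hx => (hzero x hx).2
    | succ i ih =>
      intro x hx r
      obtain ⟨h1, h2⟩ := hzero x hx
      have := ih _ h1 r
      simpa [Matrix.mulVec, dotProduct, Fintype.sum_prod_type, Fin.sum_univ_succ, h2,
        companion_succ_apply, ite_and] using this
  refine Matrix.PosDef.of_dotProduct_mulVec_pos hS.1 fun x hx => ?_
  rw [star_trivial]
  refine (hnn x).lt_of_ne' fun h0 => hx (funext fun p => hker p.1 x h0 p.2)

/-- A convergent series of real positive semidefinite matrices is positive semidefinite. -/
theorem Matrix.PosSemidef.of_hasSum {n : Type*} [Fintype n] {f : ℕ → Matrix n n ℝ}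
    {S : Matrix n n ℝ} (hf : ∀ j, (f j).PosSemidef) (h : HasSum f S) : S.PosSemidef := by
  refine .of_dotProduct_mulVec_nonneg ?_ fun x => ?_
  · have h' := h.matrix_conjTranspose
    rw [funext fun j => (hf j).1] at h'
    exact h'.unique h
  · have hφ := h.map (⟨⟨fun X => star x ⬝ᵥ X *ᵥ x, by simp⟩,
      fun X Y => by simp [Matrix.add_mulVec]⟩ : Matrix n n ℝ →+ ℝ)
      (Continuous.dotProduct continuous_const (continuous_id.matrix_mulVec continuous_const))
    exact hφ.nonneg fun j => (hf j).dotProduct_mulVec_nonneg x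

theorem stable_poly_series_blockToeplitz_posDef {m k : ℕ}
    (A : Fin k → Matrix (Fin m) (Fin m) ℝ) (hA : SchurStablePoly A)
    (M : Matrix (Fin m) (Fin m) ℝ) (hM : M.PosDef) :
    let E : Matrix (Fin k × Fin m) (Fin k × Fin m) ℝ :=
      Matrix.of fun p q => if p.1.val = 0 ∧ q.1.val = 0 then M p.2 q.2 else 0
    Summable (fun j : ℕ => companion A ^ j * E * ((companion A)ᵀ) ^ j) ∧
    (∑' j : ℕ, companion A ^ j * E * ((companion A)ᵀ) ^ j) =
      companion A * (∑' j : ℕ, companion A ^ j * E * ((companion A)ᵀ) ^ j) * (companion A)ᵀ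
        + E ∧
    (∃ U : ℕ → Matrix (Fin m) (Fin m) ℝ, (U 0).IsSymm ∧
      (∑' j : ℕ, companion A ^ j * E * ((companion A)ᵀ) ^ j) = blockToeplitz U k) ∧
    (∑' j : ℕ, companion A ^ j * E * ((companion A)ᵀ) ^ j).PosDef := by
  intro E
  have hE0 (p q) (hp : p.1.val ≠ 0) : E p q = 0 := by simp [E, hp]
  have hsum : Summable fun j : ℕ => companion A ^ j * E * (companion A)ᵀ ^ j :=
    summable_pow_mul_mul_transpose_pow _ _ hA.norm_lt_one_of_companion_mulVec
  have hstein : (∑' j : ℕ, companion A ^ j * E * (companion A)ᵀ ^ j) =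
      companion A * (∑' j : ℕ, companion A ^ j * E * (companion A)ᵀ ^ j) * (companion A)ᵀ + E := by
    conv_lhs => rw [hsum.tsum_eq_zero_add]
    rw [← hsum.tsum_mul_left, ← (hsum.mul_left _).tsum_mul_right, add_comm]
    simp only [pow_zero, one_mul, mul_one]
    congr 2
    funext j
    rw [pow_succ', pow_succ]
    simp only [mul_assoc]
  refine ⟨hsum, hstein, ?_⟩
  rcases k with _ | k
  · exact ⟨⟨0, Matrix.isSymm_zero, Subsingleton.elim _ _⟩,
      .of_dotProduct_mulVec_pos (Subsingleton.elim _ _)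
        fun x hx => (hx (Subsingleton.elim _ _)).elim⟩
  have hE (x) : x ⬝ᵥ E *ᵥ x = (fun r => x (0, r)) ⬝ᵥ M *ᵥ fun r => x (0, r) := by
    simp [E, Matrix.mulVec, dotProduct, Fintype.sum_prod_type, Fin.sum_univ_succ]
  have hEpsd : E.PosSemidef := by
    refine .of_dotProduct_mulVec_nonneg ?_ fun x => ?_
    · ext p q
      simp only [E, Matrix.conjTranspose_apply, Matrix.of_apply, star_trivial, and_comm]
      rw [← hM.1.apply p.2 q.2, star_trivial]
    · rw [star_trivial, hE]
      simpa using hM.posSemidef.dotProduct_mulVec_nonneg fun r => x (0, r)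
  have hpsd := Matrix.PosSemidef.of_hasSum (fun j => by
    simpa [Matrix.conjTranspose_eq_transpose_of_trivial, Matrix.transpose_pow] using
      hEpsd.mul_mul_conjTranspose_same (companion A ^ j)) hsum.hasSum
  exact ⟨exists_eq_blockToeplitz_of_stein
    (by simpa [Matrix.IsHermitian, Matrix.IsSymm] using hpsd.1) hE0 hstein,
    posDef_of_stein hM hpsd hE hstein⟩
end
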